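/- Let α ≥ 2 be a countable ordinal. If L ⊆ Σ^ω is a Π⁰_α-subset (respectively, Σ⁰_α-subset) of Σ^ω, then h(L) ∪ (Γ^ω − h(Σ^ω)) is a Π⁰_α-subset (respectively, Σ⁰_α-subset) of Γ^ω. -/

import Mathlib

universe u

/-- We equip `Option σ` (the alphabet `Γ = Σ ∪ {A}`, with `A = none`) with the
discrete topology. -/
instance instTopOption (σ : Type u) : TopologicalSpace (Option σ) := ⊥
instance instDiscreteOption (σ : Type u) : DiscreteTopology (Option σ) := ⟨rfl⟩

/-- Auxiliary function for the coding map `h`: reads position `i` inside the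
concatenation of the blocks `A·0^(n+1)·x(n), A·0^(n+2)·x(n+1), ...`. -/
def hAux {σ : Type u} (z : σ) (x : ℕ → σ) : ℕ → ℕ → Option σ
  | _, 0 => none
  | n, (i+1) =>
    if i + 1 ≤ n + 1 then some z
    else if i + 1 = n + 2 then some (x n)
    else hAux z x (n+1) (i + 1 - (n+3))
  termination_by n i => i
  decreasing_by omega

/-- The coding map `h : Σ^ω → Γ^ω`,
`h(x) = A·0·x(1)·A·0²·x(2)·A·0³·x(3)···A·0ⁿ·x(n)···` (ω-words indexed by `ℕ`). -/
def hmap {σ : Type u} (z : σ) (x : ℕ → σ) : ℕ → Option σ := fun i => hAux z x 0 i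

/-- Auxiliary function for the ω-word `α₀`. -/
def aAux {σ : Type u} (z : σ) : ℕ → ℕ → Option σ
  | _, 0 => none
  | n, (i+1) =>
    if i + 1 ≤ n + 1 then some z
    else aAux z (n+1) (i + 1 - (n+2))
  termination_by n i => i
  decreasing_by omega

/-- The ω-word `α₀ = A·0·A·0²·A·0³···A·0ⁿ···` over `Γ = Σ ∪ {A}`. -/
def alphaWord {σ : Type u} (z : σ) : ℕ → Option σ := fun i => aAux z 0 i

/-- The Borel hierarchy on a topological space `X`: `SigmaPi X α true` is the class
`Σ⁰_α` and `SigmaPi X α false` is the class `Π⁰_α`.  `Σ⁰_1` is the class of open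
sets, `Π⁰_1` is the class of closed sets, and for `α ≥ 2`, `Σ⁰_α` (resp. `Π⁰_α`)
is the class of countable unions (resp. intersections) of sets in
`⋃_{γ < α} Π⁰_γ` (resp. `⋃_{γ < α} Σ⁰_γ`). -/
def SigmaPi (X : Type u) [TopologicalSpace X] (α : Ordinal.{0}) (b : Bool) : Set (Set X) :=
  {s | (α = 1 ∧ ((b = true ∧ IsOpen s) ∨ (b = false ∧ IsClosed s)))
    ∨ (α ≠ 1 ∧ ∃ f : ℕ → Set X,
        (∀ n : ℕ, ∃ γ : Ordinal.{0}, ∃ _ : γ < α, f n ∈ SigmaPi X γ !b) ∧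
        s = if b then ⋃ n, f n else ⋂ n, f n)}
  termination_by α
  decreasing_by assumption

/-- The class `Σ⁰_α` of the Borel hierarchy on `X`. -/
abbrev Sigma0 (X : Type u) [TopologicalSpace X] (α : Ordinal.{0}) : Set (Set X) :=
  SigmaPi X α true

/-- The class `Π⁰_α` of the Borel hierarchy on `X`. -/
abbrev Pi0 (X : Type u) [TopologicalSpace X] (α : Ordinal.{0}) : Set (Set X) :=
  SigmaPi X α false

/-- `F ⊆ Σ^ω` is `Σ⁰_α`-complete (for `b = true`), resp. `Π⁰_α`-complete (for
`b = false`), iff for every nonempty finite alphabet `Y` and every `E ⊆ Y^ω`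
(with `Y^ω` carrying the Cantor topology, i.e. the product of the discrete
topology): `E ∈ Σ⁰_α` (resp. `Π⁰_α`) iff `E = f⁻¹(F)` for some continuous
`f : Y^ω → Σ^ω`. -/
def IsCompleteFor (b : Bool) (α : Ordinal.{0}) {σ : Type} [TopologicalSpace σ]
    (F : Set (ℕ → σ)) : Prop :=
  ∀ (Y : Type), Fintype Y → Nonempty Y → ∀ E : Set (ℕ → Y),
    letI : TopologicalSpace Y := ⊥
    (E ∈ SigmaPi (ℕ → Y) α b ↔
      ∃ f : (ℕ → Y) → (ℕ → σ), Continuous f ∧ E = f ⁻¹' F)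

/-- The infinite concatenation of the finite words `u 0, u 1, u 2, ...` equals the
ω-word `x`: every finite partial concatenation is a prefix of `x`, and the total
length is infinite. -/
def JoinsTo {α : Type u} (u : ℕ → List α) (x : ℕ → α) : Prop :=
  (∀ N : ℕ, ∃ n : ℕ, N ≤ (((List.range n).map u).flatten).length) ∧
  (∀ (n i : ℕ) (h : i < (((List.range n).map u).flatten).length),
      (((List.range n).map u).flatten)[i]'h = x i)

/-- A 2-tape Büchi automaton with input alphabet `σ` and output alphabet `γ`:
a finite set of states `Q`, a finite set `trans ⊆ Q × σ^⋆ × γ^⋆ × Q` of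
transitions, an initial state `init` and a set `acc` of accepting states. -/
structure TwoTapeBuchi (σ γ : Type u) where
  Q : Type u
  finQ : Finite Q
  trans : Set (Q × List σ × List γ × Q)
  finTrans : trans.Finite
  init : Q
  acc : Set Q

/-- The pair `(x, y)` of ω-words is accepted by the 2-tape Büchi automaton `T`
iff it is the pair of input and output words of some successful computation. -/
def TwoTapeBuchi.Accepts {σ γ : Type u} (T : TwoTapeBuchi σ γ)
    (x : ℕ → σ) (y : ℕ → γ) : Prop :=
  ∃ (q : ℕ → T.Q) (u : ℕ → List σ) (v : ℕ → List γ),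
    q 0 = T.init ∧
    (∀ n : ℕ, (q n, u n, v n, q (n+1)) ∈ T.trans) ∧
    (∃ qf ∈ T.acc, ∀ n : ℕ, ∃ m : ℕ, n ≤ m ∧ q m = qf) ∧
    JoinsTo u x ∧ JoinsTo v y

/-- `R ⊆ Σ^ω × Γ^ω` is an infinitary rational relation iff it is the relation
accepted by some 2-tape Büchi automaton. -/
def IsRatRel {σ γ : Type u} (R : Set ((ℕ → σ) × (ℕ → γ))) : Prop :=
  ∃ T : TwoTapeBuchi σ γ, ∀ p : (ℕ → σ) × (ℕ → γ), p ∈ R ↔ T.Accepts p.1 p.2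

/-- A real-time Büchi 1-counter automaton: transitions are in
`Q × σ × Bool × Q × ℤ` with the counter move in `{-1, 0, 1}`, and a zero test
(`false` means the counter is zero) which forbids decrementing a zero counter. -/
structure OneCounterBuchi (σ : Type u) where
  Q : Type u
  finQ : Finite Q
  trans : Set (Q × σ × Bool × Q × ℤ)
  transMoves : ∀ t ∈ trans, t.2.2.2.2 = -1 ∨ t.2.2.2.2 = 0 ∨ t.2.2.2.2 = 1
  transZero : ∀ t ∈ trans, t.2.2.1 = false → t.2.2.2.2 = 0 ∨ t.2.2.2.2 = 1
  init : Q
  acc : Set Q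

/-- One computation step of a 1-counter automaton on letter `a`, from
configuration `p` to configuration `p'`. -/
def OneCounterBuchi.Step {σ : Type u} (M : OneCounterBuchi σ) (a : σ)
    (p p' : M.Q × ℕ) : Prop :=
  ∃ j : ℤ, (p.1, a, (p.2 ≠ 0 : Bool), p'.1, j) ∈ M.trans ∧ (p'.2 : ℤ) = (p.2 : ℤ) + j

/-- The ω-word `x` is accepted by the real-time Büchi 1-counter automaton `M`:
there is a run on `x` starting in `(q₀, 0)` in which some accepting state occurs
infinitely often. -/
def OneCounterBuchi.Accepts {σ : Type u} (M : OneCounterBuchi σ) (x : ℕ → σ) : Prop :=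
  ∃ r : ℕ → M.Q × ℕ,
    r 0 = (M.init, 0) ∧
    (∀ i : ℕ, M.Step (x i) (r i) (r (i+1))) ∧
    ∃ qf ∈ M.acc, ∀ n : ℕ, ∃ m : ℕ, n ≤ m ∧ (r m).1 = qf

/-- The identification of a pair of ω-words with an ω-word over the product
alphabet. -/
def pairToWord {a b : Type u} (p : (ℕ → a) × (ℕ → b)) : ℕ → a × b :=
  fun n => (p.1 n, p.2 n)

theorem hAux_pos {σ : Type u} (z : σ) (n : ℕ) : ∀ k : ℕ, ∃ p : ℕ, ∀ x : ℕ → σ,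
    hAux z x k p = some (x (k + n)) := by
  induction n with
  | zero =>
    intro k
    refine ⟨k + 2, fun x => ?_⟩
    rw [hAux]
    simp
  | succ n ih =>
    intro k
    obtain ⟨p, hp⟩ := ih (k + 1)
    refine ⟨p + k + 2 + 1, fun x => ?_⟩
    rw [hAux, if_neg (by omega), if_neg (by omega)]
    have h1 : p + k + 2 + 1 - (k + 3) = p := by omega
    rw [h1, hp]
    congr 2
    omega

theorem hAux_continuous {σ : Type u} [TopologicalSpace σ] [DiscreteTopology σ] (z : σ) (i : ℕ) :
    ∀ n : ℕ, Continuous (fun x : ℕ → σ => hAux z x n i) := by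
  induction i using Nat.strong_induction_on with
  | _ i ih =>
    intro n
    cases i with
    | zero =>
      simp only [hAux]
      exact continuous_const
    | succ i =>
      by_cases h1 : i + 1 ≤ n + 1
      · have : (fun x : ℕ → σ => hAux z x n (i + 1)) = fun _ => some z := by
          funext x
          rw [hAux, if_pos h1]
        rw [this]
        exact continuous_const
      · by_cases h2 : i + 1 = n + 2
        · have : (fun x : ℕ → σ => hAux z x n (i + 1)) = fun x => some (x n) := by
            funext x
            rw [hAux, if_neg h1, if_pos h2]
          rw [this]
          exact (continuous_of_discreteTopology (f := (some : σ → Option σ))).comp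
            (continuous_apply n)
        · have : (fun x : ℕ → σ => hAux z x n (i + 1)) =
              fun x => hAux z x (n + 1) (i + 1 - (n + 3)) := by
            funext x
            rw [hAux, if_neg h1, if_neg h2]
          rw [this]
          exact ih _ (by omega) _

theorem sigmaPi_preimage {X Y : Type u} [TopologicalSpace X] [TopologicalSpace Y] {f : X → Y}
    (hf : Continuous f) (α : Ordinal.{0}) : ∀ (b : Bool) (s : Set Y), s ∈ SigmaPi Y α b →
      f ⁻¹' s ∈ SigmaPi X α b := by
  induction α using WellFoundedLT.induction with
  | _ α ih =>
    intro b s hs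
    rw [SigmaPi] at hs ⊢
    rcases hs with ⟨h1, h⟩ | ⟨h1, g, hg, rfl⟩
    · refine Or.inl ⟨h1, ?_⟩
      rcases h with ⟨hb, h⟩ | ⟨hb, h⟩
      · exact Or.inl ⟨hb, h.preimage hf⟩
      · exact Or.inr ⟨hb, h.preimage hf⟩
    · refine Or.inr ⟨h1, fun n => f ⁻¹' g n, fun n => ?_, ?_⟩
      · obtain ⟨γ, hγ, h⟩ := hg n
        exact ⟨γ, hγ, ih γ hγ _ _ h⟩
      · cases b <;> simp [Set.preimage_iInter]

theorem sigmaPi_zero {X : Type u} [TopologicalSpace X] (b : Bool) (s : Set X) :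
    s ∉ SigmaPi X 0 b := by
  intro hs
  rw [SigmaPi] at hs
  rcases hs with ⟨h1, h⟩ | ⟨h1, g, hg, rfl⟩
  · exact zero_ne_one h1
  · obtain ⟨γ, hγ, h⟩ := hg 0
    exact not_lt_bot hγ

theorem sigma_union {X : Type u} [TopologicalSpace X] (C : ℕ → Set X) (hC : ∀ n, IsClopen (C n))
    (α : Ordinal.{0}) (s : Set X) (hs : s ∈ SigmaPi X α true) :
    s ∪ ⋃ n, C n ∈ SigmaPi X α true := by
  have h0 : α ≠ 0 := by
    rintro rfl
    exact sigmaPi_zero _ _ hs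
  rw [SigmaPi] at hs ⊢
  rcases hs with ⟨h1, h⟩ | ⟨h1, g, hg, rfl⟩
  · refine Or.inl ⟨h1, Or.inl ⟨rfl, ?_⟩⟩
    rcases h with ⟨hb, h⟩ | ⟨hb, h⟩
    · exact h.union (isOpen_iUnion fun n => (hC n).isOpen)
    · cases hb
  · have h1' : 1 < α := lt_of_le_of_ne (Order.one_le_iff_pos.2 (pos_iff_ne_zero.2 h0)) (Ne.symm h1)
    refine Or.inr ⟨h1, fun n => if n % 2 = 0 then g (n / 2) else C (n / 2), fun n => ?_, ?_⟩
    · by_cases hn : n % 2 = 0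
      · simpa [hn] using hg (n / 2)
      · refine ⟨1, h1', ?_⟩
        rw [SigmaPi]
        beta_reduce
        rw [if_neg hn]
        exact Or.inl ⟨rfl, Or.inr ⟨rfl, (hC _).isClosed⟩⟩
    · simp only [if_true]
      ext x
      simp only [Set.mem_union, Set.mem_iUnion]
      constructor
      · rintro (⟨n, hn⟩ | ⟨n, hn⟩)
        · refine ⟨2 * n, ?_⟩
          rw [if_pos (by omega), show 2 * n / 2 = n by omega]
          exact hn
        · refine ⟨2 * n + 1, ?_⟩
          rw [if_neg (by omega), show (2 * n + 1) / 2 = n by omega]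
          exact hn
      · rintro ⟨n, hn⟩
        split_ifs at hn
        · exact Or.inl ⟨_, hn⟩
        · exact Or.inr ⟨_, hn⟩

theorem sigmaPi_union {X : Type u} [TopologicalSpace X] (C : ℕ → Set X)
    (hC : ∀ n, IsClopen (C n)) (α : Ordinal.{0}) (hα : 2 ≤ α) (b : Bool) (s : Set X)
    (hs : s ∈ SigmaPi X α b) : s ∪ ⋃ n, C n ∈ SigmaPi X α b := by
  cases b with
  | true => exact sigma_union C hC α s hs
  | false =>
    rw [SigmaPi] at hs ⊢
    rcases hs with ⟨h1, h⟩ | ⟨h1, g, hg, rfl⟩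
    · subst h1
      exact absurd hα (not_le.2 one_lt_two)
    · refine Or.inr ⟨h1, fun n => g n ∪ ⋃ n, C n, fun n => ?_, ?_⟩
      · obtain ⟨γ, hγ, h⟩ := hg n
        exact ⟨γ, hγ, sigma_union C hC γ _ h⟩
      · simp [Set.iInter_union]

/-- For a countable ordinal `α ≥ 2`, if `L ⊆ Σ^ω` is a `Π⁰_α`-
(resp. `Σ⁰_α`-) subset of `Σ^ω` then `h(L) ∪ (Γ^ω − h(Σ^ω))` is a `Π⁰_α`-
(resp. `Σ⁰_α`-) subset of `Γ^ω` (the boolean `b` selects the class: `true` for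
`Σ⁰_α`, `false` for `Π⁰_α`). -/
theorem hmap_image_union_compl_sigmaPi (σ : Type) [Fintype σ] [Nonempty σ]
    [TopologicalSpace σ] [DiscreteTopology σ] (z : σ)
    (α : Ordinal.{0}) (hα : 2 ≤ α) (hcount : α.card ≤ Cardinal.aleph0)
    (b : Bool) (L : Set (ℕ → σ)) (hL : L ∈ SigmaPi (ℕ → σ) α b) :
    hmap z '' L ∪ (Set.range (hmap z))ᶜ ∈ SigmaPi (ℕ → Option σ) α b := by
  choose p hp using fun n => hAux_pos z n 0
  let D : (ℕ → Option σ) → (ℕ → σ) := fun y n => (y (p n)).getD z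
  have hD : Continuous D := continuous_pi fun n =>
    (continuous_of_discreteTopology (f := fun o : Option σ => o.getD z)).comp
      (continuous_apply (p n))
  have hDh : ∀ x, D (hmap z x) = x := by
    intro x
    funext n
    simp [D, hmap, hp]
  have hh : Continuous (hmap z) := continuous_pi fun i => hAux_continuous z i 0
  let C : ℕ → Set (ℕ → Option σ) := fun i => {y | hmap z (D y) i = y i}ᶜ
  have hC : ∀ i, IsClopen (C i) := by
    intro i
    have h1 : Continuous fun y : ℕ → Option σ => (hmap z (D y) i, y i) :=
      ((continuous_apply i).comp (hh.comp hD)).prodMk (continuous_apply i)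
    exact ((isClopen_discrete {q : Option σ × Option σ | q.1 = q.2}).preimage h1).compl
  have key : hmap z '' L ∪ (Set.range (hmap z))ᶜ = D ⁻¹' L ∪ ⋃ n, C n := by
    have hr : (Set.range (hmap z))ᶜ = ⋃ n, C n := by
      rw [← Set.compl_iInter]
      congr 1
      ext y
      simp only [Set.mem_range, Set.mem_iInter, Set.mem_setOf_eq]
      constructor
      · rintro ⟨x, rfl⟩ i
        rw [hDh]
      · intro h
        exact ⟨D y, funext h⟩
    rw [← hr]
    ext y
    by_cases hy : y ∈ Set.range (hmap z)
    · obtain ⟨x, rfl⟩ := hy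
      simp only [Set.mem_union, Set.mem_compl_iff, Set.mem_range_self, not_true, or_false,
        Set.mem_preimage, hDh]
      constructor
      · rintro ⟨x', hx', he⟩
        have := congrArg D he
        rw [hDh, hDh] at this
        exact this ▸ hx'
      · intro h
        exact ⟨x, h, rfl⟩
    · exact ⟨fun _ => Or.inr hy, fun _ => Or.inr hy⟩
  rw [key]
  exact sigmaPi_union C hC α hα b _ (sigmaPi_preimage hD α b L hL)
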